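/- arXiv:2406.07468 — 3 statements merged into one kernel-verified Lean document; each statement's English description precedes it below -/
import Mathlib

section
/- Let q = 2^n and let G : 𝔽_q → 𝔽_q be a Dembowski–Ostrom polynomial, G(x) = Σ_{0 ≤ j < i ≤ n−1} c_{ij} x^{2^i + 2^j} with coefficients c_{ij} ∈ 𝔽_q. For a ∈ 𝔽_q^*, the map L_a(x) = G(x+a) + G(x) + G(a) is 𝔽_2-linear; let s_a denote the 𝔽_2-dimension of the kernel of L_a (so s_a ≥ 1 and L_a is 2^{s_a}-to-1), and set N_G = {a ∈ 𝔽_q^* : s_a > 1}. Then APN-def(G) = (q+1)·|N_G| + q·Σ_{a ∈ N_G} 2^{s_a − 2}. -/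
namespace APNPaper

open Finset

variable {F : Type*} [Field F] [Fintype F] [DecidableEq F]

/-- `δ_G(a,b)`: the number of `x` with `D_aG(x) = G(x) + G(x+a) = b`. -/
def delta (G : F → F) (a b : F) : ℕ :=
  (Finset.univ.filter fun x : F => G x + G (x + a) = b).card

/-- `∇_G(a,x) = δ_G(a, D_aG(x))`. -/
def nabla (G : F → F) (a x : F) : ℕ := delta G a (G x + G (x + a))

/-- `G` is almost perfect nonlinear. -/
def IsAPN (G : F → F) : Prop := ∀ a : F, a ≠ 0 → ∀ b : F, delta G a b ≤ 2

/-- The derivative `D_aG` is 2-to-1, i.e. `G` satisfies property `(p_a)`. -/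
def TwoToOne (G : F → F) (a : F) : Prop :=
  ∀ b : F, delta G a b = 0 ∨ delta G a b = 2

instance instDecTwoToOne (G : F → F) (a : F) : Decidable (TwoToOne G a) := by
  unfold TwoToOne; infer_instance

/-- The row spectrum `R-Spec_q(G)`. -/
def RSpec (G : F → F) : Finset F :=
  (Finset.univ.erase (0 : F)).filter fun a => TwoToOne G a

/-- `S_a = {x : ∇_G(a,x) = 2}`. -/
def Sset (G : F → F) (a : F) : Finset F :=
  Finset.univ.filter fun x : F => nabla G a x = 2

/-- `w_{S_a^c} = Σ_{b : δ_G(a,b) > 2} (δ_G(a,b)/2)²`. -/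
def wS (G : F → F) (a : F) : ℤ :=
  ∑ b : F, if 2 < delta G a b then ((delta G a b / 2 : ℕ) : ℤ) ^ 2 else 0

/-- `χ_a = 1` if `S_a = 𝔽_q`, and `0` otherwise. -/
def chi (G : F → F) (a : F) : ℤ :=
  if Sset G a = Finset.univ then 1 else 0

/-- `𝒟(G) = Σ_{a ≠ 0} (|S_a| − w_{S_a^c} + χ_a)`. -/
def Dscr (G : F → F) : ℤ :=
  ∑ a ∈ Finset.univ.erase (0 : F), (((Sset G a).card : ℤ) - wS G a + chi G a)

/-- The APN-defect `APN-def(G) = q² − 1 − 𝒟(G)`. -/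
def APNdef (G : F → F) : ℤ := (Fintype.card F : ℤ) ^ 2 - 1 - Dscr G

/-- The differential uniformity `δ_G`. -/
def diffUnif (G : F → F) : ℕ :=
  ((Finset.univ.erase (0 : F)) ×ˢ Finset.univ).sup fun p => delta G p.1 p.2

/-- The set of vanishing flats of `G`. -/
def VF (G : F → F) : Set (Finset F) :=
  {S | ∃ x y z : F, x ≠ y ∧ x ≠ z ∧ y ≠ z ∧
    G x + G y + G z + G (x + y + z) = 0 ∧ S = ({x, y, z, x + y + z} : Finset F)}

/-- The absolute trace `Tr(z) = z + z² + ⋯ + z^{2^{n-1}}` (with values in `{0,1} ⊆ F`). -/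
def Tr (n : ℕ) (z : F) : F := ∑ i ∈ Finset.range n, z ^ (2 ^ i)

/-- The modification `F_{0,α}` of the inverse function: the values of the inverse
function at `0` and `α` are swapped. -/
def Fmod (α : F) : F → F :=
  fun x => if x = 0 then α⁻¹ else if x = α then 0 else x⁻¹

/-- The map `x ↦ G(x+a) + G(x) + G(a)` is additive for a Dembowski–Ostrom polynomial `G`. -/
theorem polar_add {K : Type*} [Field K] [CharP K 2] (n : ℕ) (c : ℕ → ℕ → K) (G : K → K)
    (hG : ∀ x : K, G x = ∑ i ∈ Finset.range n, ∑ j ∈ Finset.range i,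
      c i j * x ^ (2 ^ i + 2 ^ j)) (a x y : K) :
    G (x + y + a) + G (x + y) + G a =
      (G (x + a) + G x + G a) + (G (y + a) + G y + G a) := by
  simp only [hG, ← Finset.sum_add_distrib]
  refine Finset.sum_congr rfl fun i _ => Finset.sum_congr rfl fun j _ => ?_
  have h2 : (2 : K) = 0 := CharTwo.two_eq_zero
  simp only [pow_add, add_pow_char_pow]
  linear_combination (c i j * (x ^ 2 ^ i * y ^ 2 ^ j + y ^ 2 ^ i * x ^ 2 ^ j
    - a ^ 2 ^ i * a ^ 2 ^ j)) * h2

/-- If `x ↦ G(x+a) + G(x) + G(a)` is additive, every nonempty fibre of `D_aG` has the size of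
its kernel. -/
theorem nabla_eq_card_ker [CharP F 2] (G : F → F) (a : F)
    (hadd : ∀ x y : F, G (x + y + a) + G (x + y) + G a =
      (G (x + a) + G x + G a) + (G (y + a) + G y + G a)) (x : F) :
    nabla G a x = (Finset.univ.filter fun t : F => G (t + a) + G t + G a = 0).card := by
  unfold nabla delta
  have h2 : (2 : F) = 0 := CharTwo.two_eq_zero
  symm
  refine Finset.card_bij (fun t _ => x + t) ?_ ?_ ?_
  · intro t ht
    simp only [Finset.mem_filter, Finset.mem_univ, true_and] at ht ⊢
    linear_combination hadd x t + ht
  · intro t _ u _ h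
    exact add_left_cancel h
  · intro z hz
    simp only [Finset.mem_filter, Finset.mem_univ, true_and] at hz
    have hxz : x + (x + z) = z := by linear_combination x * h2
    refine ⟨x + z, ?_, hxz⟩
    simp only [Finset.mem_filter, Finset.mem_univ, true_and]
    linear_combination hadd x z + hz + (G x + G (x + a) + G a) * h2

/-- The fibres of `D_aG` partition the field. -/
theorem sum_delta (G : F → F) (a : F) : ∑ b : F, delta G a b = Fintype.card F := by
  unfold delta
  rw [← Finset.card_univ]
  exact (Finset.card_eq_sum_card_fiberwise fun x _ => Finset.mem_coe.2 (Finset.mem_univ _)).symm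

/-- A fibre of `D_aG` is empty or has the common size of the nonempty fibres. -/
theorem delta_eq_zero_or (G : F → F) (a : F) (m : ℕ) (h : ∀ x, nabla G a x = m) (b : F) :
    delta G a b = 0 ∨ delta G a b = m := by
  rcases Finset.eq_empty_or_nonempty (Finset.univ.filter fun x : F => G x + G (x + a) = b) with
    he | ⟨x, hx⟩
  · exact Or.inl (by rw [delta, he, Finset.card_empty])
  · right
    rw [← h x, nabla, (Finset.mem_filter.1 hx).2]

/-- The contribution of a direction whose derivative is 2-to-1. -/
theorem contribution_of_nabla_eq_two (G : F → F) (a : F) (h : ∀ x, nabla G a x = 2) :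
    ((Sset G a).card : ℤ) - wS G a + chi G a = Fintype.card F + 1 := by
  have hS : Sset G a = Finset.univ := by simp [Sset, h]
  have hw : wS G a = 0 := by
    refine Finset.sum_eq_zero fun b _ => if_neg ?_
    rcases delta_eq_zero_or G a 2 h b with hb | hb <;> omega
  simp [chi, hS, hw]

/-- The contribution of a direction whose derivative is `2^(k+2)`-to-1. -/
theorem contribution_of_nabla_eq_two_pow (G : F → F) (a : F) (k : ℕ)
    (h : ∀ x, nabla G a x = 2 ^ (k + 2)) :
    ((Sset G a).card : ℤ) - wS G a + chi G a = -(Fintype.card F * 2 ^ k) := by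
  have hk : 2 < 2 ^ (k + 2) := by
    have := Nat.one_le_two_pow (n := k)
    rw [pow_add]
    omega
  have hS : Sset G a = ∅ := by simp [Sset, h, hk.ne']
  have hw : wS G a = Fintype.card F * 2 ^ k := by
    rw [wS, ← sum_delta G a, Nat.cast_sum, Finset.sum_mul]
    refine Finset.sum_congr rfl fun b _ => ?_
    rcases delta_eq_zero_or G a _ h b with hb | hb
    · simp [hb]
    · have hdiv : 2 ^ (k + 2) / 2 = 2 ^ (k + 1) := by
        rw [pow_succ 2 (k + 1), Nat.mul_div_cancel _ two_pos]
      rw [hb, if_pos hk, hdiv]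
      push_cast
      ring
  have hne : (∅ : Finset F) ≠ Finset.univ := Finset.univ_nonempty.ne_empty.symm
  simp [chi, hS, hw, hne]

/-- the APN-defect of a Dembowski–Ostrom polynomial. -/
theorem stmt_4 (n : ℕ) (hn : 0 < n)
    [CharP F 2] (hcard : Fintype.card F = 2 ^ n)
    (c : ℕ → ℕ → F) (G : F → F)
    (hG : ∀ x : F, G x = ∑ i ∈ Finset.range n, ∑ j ∈ Finset.range i,
      c i j * x ^ (2 ^ i + 2 ^ j))
    (s : F → ℕ)
    (hs : ∀ a : F, a ≠ 0 →
      (Finset.univ.filter fun x : F => G (x + a) + G x + G a = 0).card = 2 ^ s a) :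
    APNdef G =
      ((2 : ℤ) ^ n + 1) *
          ((((Finset.univ.erase (0 : F)).filter fun a => 1 < s a).card : ℤ)) +
        (2 : ℤ) ^ n *
          ∑ a ∈ (Finset.univ.erase (0 : F)).filter fun a => 1 < s a,
            (2 : ℤ) ^ (s a - 2) := by
  have hpos (a : F) (ha : a ≠ 0) : 1 ≤ s a := by
    by_contra hlt
    have h0 : s a = 0 := by omega
    have hG0 : G 0 = 0 := by simp [hG]
    have hcard_one := hs a ha
    rw [h0, pow_zero, Finset.card_eq_one] at hcard_one
    obtain ⟨t, ht⟩ := hcard_one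
    have h1 : (0 : F) ∈ ({t} : Finset F) := by
      rw [← ht]
      simp [hG0, CharTwo.add_self_eq_zero]
    have h2 : a ∈ ({t} : Finset F) := by
      rw [← ht]
      simp [hG0, CharTwo.add_self_eq_zero]
    rw [Finset.mem_singleton] at h1 h2
    exact ha (h2.trans h1.symm)
  have hnabla (a : F) (ha : a ≠ 0) (x : F) : nabla G a x = 2 ^ s a := by
    rw [nabla_eq_card_ker G a (polar_add n c G hG a) x, hs a ha]
  have hterm (a : F) (ha : a ∈ Finset.univ.erase (0 : F)) :
      ((Sset G a).card : ℤ) - wS G a + chi G a =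
        (2 ^ n + 1) - if 1 < s a then (2 ^ n + 1) + 2 ^ n * 2 ^ (s a - 2) else 0 := by
    have ha0 := Finset.ne_of_mem_erase ha
    split_ifs with hsa
    · obtain ⟨k, hk⟩ := Nat.exists_eq_add_of_le' hsa
      rw [contribution_of_nabla_eq_two_pow G a k fun x => by rw [hnabla a ha0 x, hk], hcard, hk,
        Nat.add_sub_cancel]
      push_cast
      ring
    · have h1 : s a = 1 := by have := hpos a ha0; omega
      rw [contribution_of_nabla_eq_two G a fun x => by rw [hnabla a ha0 x, h1, pow_one], hcard]
      push_cast
      ring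
  rw [APNdef, Dscr, Finset.sum_congr rfl hterm, Finset.sum_sub_distrib, ← Finset.sum_filter,
    Finset.sum_add_distrib (s := Finset.filter _ _), ← Finset.mul_sum, Finset.sum_const,
    Finset.sum_const,
    Finset.card_erase_of_mem (Finset.mem_univ _), Finset.card_univ, hcard, nsmul_eq_mul,
    nsmul_eq_mul, Nat.cast_sub Nat.one_le_two_pow]
  push_cast
  ring


end APNPaper
end

section
/- Let n ≥ 3 be odd, q = 2^n, and α ∈ 𝔽_q^*. Let k = |R-Spec_q(F_{0,α})| and ℓ = |{a ∈ 𝔽_q \ {0, α} : Tr(α/(a+α)) = 0 and Tr(α/a) = 1}|. Then APN-def(F_{0,α}) = 9q + 8ℓ − 9k − 9. -/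
namespace APNPaper

open Finset

variable {F : Type*} [Field F] [Fintype F] [DecidableEq F]

section TwoToOneDerivatives

theorem card_Sset_eq_sum (G : F → F) (a : F) :
    (Sset G a).card = ∑ b : F, if delta G a b = 2 then 2 else 0 := by
  rw [Finset.card_eq_sum_card_fiberwise (f := fun x => G x + G (x + a)) (t := Finset.univ)
    (by intro x _; simp)]
  refine Finset.sum_congr rfl fun b _ => ?_
  by_cases hb : delta G a b = 2
  · rw [if_pos hb, ← hb, delta, Sset, Finset.filter_filter]
    congr 1
    ext x
    simp only [Finset.mem_filter, Finset.mem_univ, true_and, and_iff_right_iff_imp]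
    rintro rfl
    exact hb
  · rw [if_neg hb, Finset.card_eq_zero, Sset, Finset.filter_filter]
    ext x
    simp only [Finset.mem_filter, Finset.mem_univ, true_and, Finset.notMem_empty,
      iff_false, not_and]
    rintro h rfl
    exact hb h

theorem card_Sset_sub_wS (G : F → F) (a : F)
    (h : ∀ b, delta G a b = 0 ∨ delta G a b = 2 ∨ delta G a b = 4) :
    ((Sset G a).card : ℤ) - wS G a =
      Fintype.card F - 8 * ((Finset.univ.filter fun b => delta G a b = 4).card : ℤ) := by
  rw [card_Sset_eq_sum, wS, ← sum_delta G a, Finset.card_filter]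
  push_cast
  rw [Finset.mul_sum, ← Finset.sum_sub_distrib, ← Finset.sum_sub_distrib]
  refine Finset.sum_congr rfl fun b _ => ?_
  rcases h b with h | h | h <;> norm_num [h]

theorem Sset_eq_univ_iff (G : F → F) (a : F) : Sset G a = Finset.univ ↔ TwoToOne G a := by
  simp only [Sset, Finset.filter_eq_self, Finset.mem_univ, true_implies, TwoToOne]
  constructor
  · intro h b
    by_cases hb : ∃ x, G x + G (x + a) = b
    · obtain ⟨x, rfl⟩ := hb
      exact Or.inr (h x)
    · left
      rw [delta, Finset.card_eq_zero, Finset.filter_eq_empty_iff]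
      exact fun x _ hx => hb ⟨x, hx⟩
  · intro h x
    refine (h _).resolve_left ?_
    rw [delta, Finset.card_eq_zero, Finset.filter_eq_empty_iff]
    exact fun h => h (Finset.mem_univ x) rfl

theorem twoToOne_iff_card_filter_eq_zero (G : F → F) (a : F)
    (h : ∀ b, delta G a b = 0 ∨ delta G a b = 2 ∨ delta G a b = 4) :
    TwoToOne G a ↔ (Finset.univ.filter fun b => delta G a b = 4).card = 0 := by
  rw [Finset.card_eq_zero, Finset.filter_eq_empty_iff]
  refine forall_congr' fun b => ?_
  rcases h b with h | h | h <;> simp [h]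

end TwoToOneDerivatives

section Trace

variable {F : Type*} [Field F]

theorem Tr_add [CharP F 2] (n : ℕ) (x y : F) : Tr n (x + y) = Tr n x + Tr n y := by
  simp only [Tr, ← Finset.sum_add_distrib]
  exact Finset.sum_congr rfl fun i _ => add_pow_char_pow x y 2 i

theorem Tr_sq_add [CharP F 2] (n : ℕ) (x : F) : Tr n x ^ 2 + Tr n x = x ^ 2 ^ n + x := by
  induction n with
  | zero => simp [Tr, CharTwo.add_self_eq_zero]
  | succ n ih =>
    have h : Tr (n + 1) x = Tr n x + x ^ 2 ^ n := by simp [Tr, Finset.sum_range_succ]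
    rw [h, CharTwo.add_sq, ← pow_mul, ← pow_succ]
    have h2 : (2 : F) = 0 := CharTwo.two_eq_zero
    linear_combination ih + x ^ 2 ^ n * h2

variable [Fintype F] [CharP F 2] {n : ℕ} (hcard : Fintype.card F = 2 ^ n)

include hcard

omit [Fintype F] hcard in
theorem Tr_one (hodd : Odd n) : Tr n (1 : F) = 1 := by
  obtain ⟨m, rfl⟩ := hodd
  simp [Tr, CharTwo.two_eq_zero]

omit [Fintype F] hcard in
theorem halfTrace_sq_add (m : ℕ) (x : F) :
    (∑ i ∈ Finset.range m, x ^ 2 ^ (2 * i)) ^ 2 + ∑ i ∈ Finset.range m, x ^ 2 ^ (2 * i)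
      = Tr (2 * m) x := by
  induction m with
  | zero => simp [Tr]
  | succ m ih =>
    have h : Tr (2 * (m + 1)) x = Tr (2 * m) x + x ^ 2 ^ (2 * m) + x ^ 2 ^ (2 * m + 1) := by
      simp [Tr, Finset.sum_range_succ, mul_add]
    rw [Finset.sum_range_succ, CharTwo.add_sq, ← pow_mul, ← pow_succ, h]
    linear_combination ih

theorem Tr_eq_zero_iff (hodd : Odd n) (x : F) : Tr n x = 0 ↔ ∃ t, t ^ 2 + t = x := by
  constructor
  · intro h
    obtain ⟨m, rfl⟩ := hodd
    refine ⟨_, (halfTrace_sq_add (m + 1) x).trans ?_⟩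
    have h' : Tr (2 * (m + 1)) x = Tr (2 * m + 1) x + x ^ 2 ^ (2 * m + 1) := by
      simp [Tr, Finset.sum_range_succ, mul_add]
    rw [h', h, ← hcard, FiniteField.pow_card, zero_add]
  · rintro ⟨t, rfl⟩
    have h : Tr n (t ^ 2) = Tr n t ^ 2 := by
      simp only [Tr, CharTwo.sum_sq, ← pow_mul, mul_comm]
    rw [Tr_add, h, Tr_sq_add, ← hcard, FiniteField.pow_card, CharTwo.add_self_eq_zero]

theorem Tr_eq_one_iff (hodd : Odd n) (x : F) : Tr n x = 1 ↔ ∃ t, t ^ 2 + t = 1 + x := by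
  rw [← Tr_eq_zero_iff hcard hodd, Tr_add, Tr_one hodd, CharTwo.add_eq_zero, eq_comm]

theorem sq_add_self_ne_one (hodd : Odd n) (t : F) : t ^ 2 + t ≠ 1 := by
  intro h
  have := (Tr_eq_zero_iff hcard hodd 1).mpr ⟨t, h⟩
  rw [Tr_one hodd] at this
  exact one_ne_zero this

end Trace

section InverseDerivative

variable {F : Type*} [Field F] [CharP F 2] {a : F}

theorem inv_add_inv_add_eq_iff {x : F} (hx0 : x ≠ 0) (hxa : x ≠ a) (b : F) :
    x⁻¹ + (x + a)⁻¹ = b ↔ b * (x ^ 2 + a * x) = a := by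
  have h2 : (2 : F) = 0 := CharTwo.two_eq_zero
  have hxa' : x + a ≠ 0 := fun h => hxa (CharTwo.add_eq_zero.mp h)
  field_simp
  constructor <;> intro h <;> linear_combination -h + x * h2

theorem eq_or_eq_add_of_mul_eq (ha : a ≠ 0) {b x y : F}
    (hx : b * (x ^ 2 + a * x) = a) (hy : b * (y ^ 2 + a * y) = a) : x = y ∨ x = y + a := by
  have h2 : (2 : F) = 0 := CharTwo.two_eq_zero
  have hb : b ≠ 0 := by
    rintro rfl
    exact ha (by rw [← hx, zero_mul])
  have : (x + y) * (x + (y + a)) = 0 := by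
    apply mul_left_cancel₀ hb
    linear_combination hx + hy + b * (x * y) * h2 + a * h2
  simpa only [mul_eq_zero, CharTwo.add_eq_zero] using this

end InverseDerivative

section Fmod

variable {F : Type*} [Field F] [Fintype F] [DecidableEq F] [CharP F 2] {α a : F}

omit [Fintype F] in
theorem Fmod_add_Fmod_eq_iff (hα : α ≠ 0) (ha : a ≠ 0) (haα : a ≠ α) (x b : F) :
    Fmod α x + Fmod α (x + a) = b ↔
      (x = 0 ∨ x = a) ∧ b = α⁻¹ + a⁻¹ ∨ (x = α ∨ x = α + a) ∧ b = (α + a)⁻¹ ∨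
      (x ≠ 0 ∧ x ≠ a ∧ x ≠ α ∧ x ≠ α + a) ∧ b * (x ^ 2 + a * x) = a := by
  have hαa : α + a ≠ 0 := fun h => haα (CharTwo.add_eq_zero.mp h).symm
  by_cases h0 : x = 0
  · subst h0
    simp [Fmod, hα.symm, ha, haα, ha.symm, hαa.symm, eq_comm]
  by_cases h1 : x = a
  · subst h1
    simp [Fmod, hα, ha, haα, CharTwo.add_self_eq_zero, eq_comm, add_comm]
  by_cases h2 : x = α
  · subst h2
    simp [Fmod, hα, ha, hαa, haα.symm, eq_comm]
  by_cases h3 : x = α + a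
  · subst h3
    simp [Fmod, hα, ha, hαa, CharTwo.add_cancel_right, eq_comm]
  have h4 : x + a ≠ 0 := fun h => h1 (CharTwo.add_eq_zero.mp h)
  have h5 : x + a ≠ α := by
    rintro rfl
    exact h3 (by rw [CharTwo.add_cancel_right])
  rw [← inv_add_inv_add_eq_iff h0 h1]
  simp [Fmod, h0, h1, h2, h3, h4, h5]

theorem delta_Fmod_self (hα : α ≠ 0) (b : F) (h : ∀ t : F, t ^ 2 + t ≠ 1) :
    delta (Fmod α) α b = 0 ∨ delta (Fmod α) α b = 2 := by
  have key : ∀ x, Fmod α x + Fmod α (x + α) = b ↔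
      (x = 0 ∨ x = α) ∧ b = α⁻¹ ∨ (x ≠ 0 ∧ x ≠ α) ∧ b * (x ^ 2 + α * x) = α := by
    intro x
    by_cases h0 : x = 0
    · subst h0
      simp [Fmod, hα, eq_comm]
    by_cases h1 : x = α
    · subst h1
      simp [Fmod, h0, CharTwo.add_self_eq_zero, eq_comm]
    have h4 : x + α ≠ 0 := fun h => h1 (CharTwo.add_eq_zero.mp h)
    rw [← inv_add_inv_add_eq_iff h0 h1]
    simp [Fmod, h0, h1, h4]
  by_cases hb : ∃ x, Fmod α x + Fmod α (x + α) = b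
  · right
    obtain ⟨x, hx⟩ := hb
    rw [delta, Finset.card_eq_two]
    refine ⟨x, x + α, by simpa using hα, ?_⟩
    ext y
    simp only [Finset.mem_filter, Finset.mem_univ, true_and, Finset.mem_insert,
      Finset.mem_singleton]
    constructor
    · intro hy
      have no : ∀ z, α⁻¹ * (z ^ 2 + α * z) ≠ α := by
        intro z hz
        apply h (z / α)
        field_simp at hz ⊢
        linear_combination hz
      rw [key] at hx hy
      rcases hx with ⟨hx, hbx⟩ | ⟨-, hx⟩
      · rcases hy with ⟨hy, -⟩ | ⟨-, hy⟩
        · rcases hx with rfl | rfl <;> rcases hy with rfl | rfl <;>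
            simp [CharTwo.add_self_eq_zero]
        · exact absurd (hbx ▸ hy) (no y)
      · rcases hy with ⟨-, hby⟩ | ⟨-, hy⟩
        · exact absurd (hby ▸ hx) (no x)
        · exact eq_or_eq_add_of_mul_eq hα hy hx
    · rintro (rfl | rfl)
      · exact hx
      · rwa [CharTwo.add_cancel_right, add_comm]
  · left
    rw [delta, Finset.card_eq_zero, Finset.filter_eq_empty_iff]
    exact fun x _ hx => hb ⟨x, hx⟩

/-- The solutions `x` of `D_aF_{0,α}(x) = b` at which both `x` and `x + a` avoid `0` and `α`. -/
def unmodifiedFiber (α a b : F) : Finset F :=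
  Finset.univ.filter fun x =>
    (x ≠ 0 ∧ x ≠ a ∧ x ≠ α ∧ x ≠ α + a) ∧ b * (x ^ 2 + a * x) = a

theorem card_unmodifiedFiber (ha : a ≠ 0) (b : F) :
    (unmodifiedFiber α a b).card = if (unmodifiedFiber α a b).Nonempty then 2 else 0 := by
  have h2 : (2 : F) = 0 := CharTwo.two_eq_zero
  split_ifs with h
  · obtain ⟨x, hx⟩ := h
    rw [Finset.card_eq_two]
    refine ⟨x, x + a, by simpa using ha, ?_⟩
    ext y
    simp only [unmodifiedFiber, Finset.mem_filter, Finset.mem_univ, true_and,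
      Finset.mem_insert, Finset.mem_singleton] at hx ⊢
    constructor
    · intro hy
      exact eq_or_eq_add_of_mul_eq ha hy.2 hx.2
    · rintro (rfl | rfl)
      · exact hx
      · obtain ⟨⟨h0, h1, h3, h4⟩, hb⟩ := hx
        refine ⟨⟨fun h => h1 (CharTwo.add_eq_zero.mp h), by simpa using h0, ?_, by simpa using h3⟩,
          ?_⟩
        · rintro rfl
          exact h4 (by rw [CharTwo.add_cancel_right])
        · linear_combination hb + b * (x * a + a ^ 2) * h2
  · simpa [Finset.not_nonempty_iff_eq_empty] using h

theorem delta_Fmod (hα : α ≠ 0) (ha : a ≠ 0) (haα : a ≠ α) (b : F) :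
    delta (Fmod α) a b = (if b = α⁻¹ + a⁻¹ then 2 else 0) + (if b = (α + a)⁻¹ then 2 else 0) +
      if (unmodifiedFiber α a b).Nonempty then 2 else 0 := by
  have h : (Finset.univ.filter fun x => Fmod α x + Fmod α (x + a) = b) =
      ((if b = α⁻¹ + a⁻¹ then {0, a} else ∅) ∪ (if b = (α + a)⁻¹ then {α, α + a} else ∅)) ∪
        unmodifiedFiber α a b := by
    ext x
    rw [Finset.mem_filter, Fmod_add_Fmod_eq_iff hα ha haα]
    simp only [Finset.mem_union, unmodifiedFiber, Finset.mem_filter, Finset.mem_univ, true_and,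
      or_assoc]
    split_ifs <;>
      simp only [Finset.mem_insert, Finset.mem_singleton, Finset.notMem_empty] <;> tauto
  rw [delta, h, Finset.card_union_of_disjoint, Finset.card_union_of_disjoint,
    card_unmodifiedFiber ha]
  · congr 2
    · split_ifs
      · exact Finset.card_pair ha.symm
      · rfl
    · split_ifs
      · exact Finset.card_pair (by simpa using ha)
      · rfl
  · split_ifs <;> simp [hα, haα.symm, CharTwo.add_eq_zero]
  · rw [Finset.disjoint_right]
    intro x hx
    simp only [unmodifiedFiber, Finset.mem_filter] at hx
    split_ifs <;> simp [hx.2.1]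

theorem unmodifiedFiber_nonempty_iff (ha : a ≠ 0) {b : F} (hb : b * (α ^ 2 + a * α) ≠ a) :
    (unmodifiedFiber α a b).Nonempty ↔ ∃ t, b * a * (t ^ 2 + t) = 1 := by
  have h2 : (2 : F) = 0 := CharTwo.two_eq_zero
  simp only [unmodifiedFiber, Finset.Nonempty, Finset.mem_filter, Finset.mem_univ, true_and]
  constructor
  · rintro ⟨x, -, hx⟩
    refine ⟨x / a, ?_⟩
    field_simp
    linear_combination hx
  · rintro ⟨t, ht⟩
    have hx : b * ((a * t) ^ 2 + a * (a * t)) = a := by linear_combination a * ht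
    generalize a * t = x at hx
    refine ⟨x, ⟨?_, ?_, ?_, ?_⟩, hx⟩
    · rintro rfl
      exact ha (by linear_combination -hx)
    · rintro rfl
      exact ha (by linear_combination -hx + b * x ^ 2 * h2)
    · rintro rfl
      exact hb hx
    · rintro rfl
      exact hb (by linear_combination hx - b * (α * a + a ^ 2) * h2)

theorem unmodifiedFiber_inv_add_inv_nonempty_iff (hα : α ≠ 0) (ha : a ≠ 0) (haα : a ≠ α) :
    (unmodifiedFiber α a (α⁻¹ + a⁻¹)).Nonempty ↔ ∃ t, t ^ 2 + t = α / (a + α) := by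
  have h2 : (2 : F) = 0 := CharTwo.two_eq_zero
  have haα' : a + α ≠ 0 := fun h => haα (CharTwo.add_eq_zero.mp h)
  rw [unmodifiedFiber_nonempty_iff ha]
  · refine exists_congr fun t => ?_
    rw [eq_div_iff haα']
    field_simp
  · intro h
    field_simp at h
    exact hα (pow_eq_zero_iff two_ne_zero |>.mp (by linear_combination h - a * α * h2))

theorem unmodifiedFiber_add_inv_nonempty_iff (ha : a ≠ 0) (haα : a ≠ α) :
    (unmodifiedFiber α a (α + a)⁻¹).Nonempty ↔ ∃ t, t ^ 2 + t = 1 + α / a := by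
  have haα' : α + a ≠ 0 := fun h => haα (CharTwo.add_eq_zero.mp h).symm
  rw [unmodifiedFiber_nonempty_iff ha]
  · refine exists_congr fun t => ?_
    field_simp
    rw [add_comm a α]
  · intro h
    field_simp at h
    exact haα h.symm

omit [Fintype F] [DecidableEq F] in
theorem inv_add_inv_ne_add_inv (hα : α ≠ 0) (ha : a ≠ 0) (haα : a ≠ α)
    (h : ∀ t : F, t ^ 2 + t ≠ 1) : α⁻¹ + a⁻¹ ≠ (α + a)⁻¹ := by
  have h2 : (2 : F) = 0 := CharTwo.two_eq_zero
  have haα' : α + a ≠ 0 := fun h => haα (CharTwo.add_eq_zero.mp h).symm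
  intro h'
  apply h (α / a)
  field_simp at h' ⊢
  linear_combination h' - a ^ 2 * h2

theorem delta_Fmod_eq (hα : α ≠ 0) (ha : a ≠ 0) (haα : a ≠ α) (h : ∀ t : F, t ^ 2 + t ≠ 1)
    (b : F) :
    delta (Fmod α) a b = 0 ∨ delta (Fmod α) a b = 2 ∨ delta (Fmod α) a b = 4 := by
  have hne := inv_add_inv_ne_add_inv hα ha haα h
  rw [delta_Fmod hα ha haα]
  split_ifs with h0 h1 <;> first | exact absurd (h0.symm.trans h1) hne | simp

theorem filter_delta_Fmod_eq_four (hα : α ≠ 0) (ha : a ≠ 0) (haα : a ≠ α)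
    (h : ∀ t : F, t ^ 2 + t ≠ 1) :
    (Finset.univ.filter fun b => delta (Fmod α) a b = 4) =
      ({α⁻¹ + a⁻¹, (α + a)⁻¹} : Finset F).filter fun b => (unmodifiedFiber α a b).Nonempty := by
  have hne := inv_add_inv_ne_add_inv hα ha haα h
  ext b
  simp only [delta_Fmod hα ha haα, Finset.mem_filter, Finset.mem_univ, true_and,
    Finset.mem_insert, Finset.mem_singleton]
  split_ifs with h0 h1 <;> first | exact absurd (h0.symm.trans h1) hne | grind

theorem card_filter_delta_Fmod_eq_four (hα : α ≠ 0) (ha : a ≠ 0) (haα : a ≠ α)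
    (h : ∀ t : F, t ^ 2 + t ≠ 1) {A B : Prop} [Decidable A] [Decidable B]
    (hA : A ↔ ∃ t, t ^ 2 + t = α / (a + α)) (hB : B ↔ ∃ t, t ^ 2 + t = 1 + α / a) :
    (Finset.univ.filter fun b => delta (Fmod α) a b = 4).card =
      (if A then 1 else 0) + if B then 1 else 0 := by
  rw [filter_delta_Fmod_eq_four hα ha haα h, Finset.card_filter,
    Finset.sum_pair (inv_add_inv_ne_add_inv hα ha haα h)]
  simp only [unmodifiedFiber_inv_add_inv_nonempty_iff hα ha haα,
    unmodifiedFiber_add_inv_nonempty_iff ha haα, ← hA, ← hB]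

theorem card_Sset_Fmod_sub_wS_add_chi {n : ℕ} (hodd : Odd n) (hcard : Fintype.card F = 2 ^ n)
    (hα : α ≠ 0) (ha : a ≠ 0) :
    ((Sset (Fmod α) a).card : ℤ) - wS (Fmod α) a + chi (Fmod α) a =
      Fintype.card F - 8 + 9 * (if TwoToOne (Fmod α) a then 1 else 0) -
        8 * (if a ≠ 0 ∧ a ≠ α ∧ Tr n (α / (a + α)) = 0 ∧ Tr n (α / a) = 1 then 1 else 0) := by
  have h1 := sq_add_self_ne_one hcard hodd
  simp only [chi, Sset_eq_univ_iff]
  by_cases haα : a = α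
  · subst haα
    have h : TwoToOne (Fmod a) a := fun b => delta_Fmod_self hα b h1
    have h' : ∀ b, delta (Fmod a) a b = 0 ∨ delta (Fmod a) a b = 2 ∨ delta (Fmod a) a b = 4 :=
      fun b => (h b).imp_right Or.inl
    rw [card_Sset_sub_wS _ _ h', (twoToOne_iff_card_filter_eq_zero _ _ h').mp h]
    simp only [h, ne_eq, not_true_eq_false, false_and, and_false, if_true, if_false]
    ring
  · have h' := delta_Fmod_eq hα ha haα h1
    rw [card_Sset_sub_wS _ _ h']
    simp only [twoToOne_iff_card_filter_eq_zero _ _ h',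
      card_filter_delta_Fmod_eq_four hα ha haα h1 (Tr_eq_zero_iff hcard hodd _)
        (Tr_eq_one_iff hcard hodd _)]
    by_cases hA : Tr n (α / (a + α)) = 0 <;> by_cases hB : Tr n (α / a) = 1 <;>
      simp [hA, hB, ha, haα] <;> ring

end Fmod

/-- the APN-defect of `F_{0,α}` for odd `n ≥ 3`. -/
theorem stmt_12 (n : ℕ) (hn : 3 ≤ n) (hodd : Odd n)
    [CharP F 2] (hcard : Fintype.card F = 2 ^ n)
    (α : F) (hα : α ≠ 0) (k ℓ : ℕ)
    (hk : k = (RSpec (Fmod α)).card)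
    (hℓ : ℓ = ((Finset.univ.filter fun a : F =>
      a ≠ 0 ∧ a ≠ α ∧ Tr n (α / (a + α)) = 0 ∧ Tr n (α / a) = 1)).card) :
    APNdef (Fmod α) = 9 * (2 : ℤ) ^ n + 8 * (ℓ : ℤ) - 9 * (k : ℤ) - 9 := by
  have hsum := Finset.sum_congr (rfl : Finset.univ.erase (0 : F) = _) fun a ha =>
    card_Sset_Fmod_sub_wS_add_chi hodd hcard hα (Finset.ne_of_mem_erase ha)
  have hk' : ∑ a ∈ Finset.univ.erase (0 : F), (if TwoToOne (Fmod α) a then 1 else 0 : ℤ) = k := by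
    rw [hk, RSpec, Finset.sum_boole]
  have hℓ' : ∑ a ∈ Finset.univ.erase (0 : F),
      (if a ≠ 0 ∧ a ≠ α ∧ Tr n (α / (a + α)) = 0 ∧ Tr n (α / a) = 1 then 1 else 0 : ℤ) = ℓ := by
    rw [hℓ, Finset.card_filter, Finset.sum_erase _ (by simp)]
    push_cast
    rfl
  change Dscr (Fmod α) = _ at hsum
  rw [Finset.sum_sub_distrib, Finset.sum_add_distrib, ← Finset.mul_sum, ← Finset.mul_sum, hk',
    hℓ', Finset.sum_const, Finset.card_erase_of_mem (Finset.mem_univ _), Finset.card_univ,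
    nsmul_eq_mul, Nat.cast_sub Fintype.card_pos, hcard] at hsum
  rw [APNdef, hsum, hcard]
  push_cast
  ring

end APNPaper
end

section
/- Let n ≥ 4 be even, q = 2^n, α ∈ 𝔽_q^*, and let F(x) = x^{q−2} be the inverse function. Then |VF_{F_{0,α}}| = |VF_F| = (q−1)/3. -/
namespace APNPaper

open Finset

variable {F : Type*} [Field F] [Fintype F] [DecidableEq F]

section GeneralFlats

variable {K : Type*} [Field K]

lemma cubeRoot_inv {ω : K} (hω : ω ^ 2 + ω + 1 = 0) : ω⁻¹ = ω ^ 2 ∧ (ω ^ 2)⁻¹ = ω := by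
  have : ω ^ 3 = 1 := by linear_combination (ω - 1) * hω
  have : ω ≠ 0 := by rintro rfl; simp at hω
  constructor <;> field_simp <;> grind

lemma pow_three_eq_one_iff {ω : K} (hω : ω ^ 2 + ω + 1 = 0) (u : K) :
    u ^ 3 = 1 ↔ u = 1 ∨ u = ω ∨ u = ω ^ 2 := by
  have : u ^ 3 - 1 = (u - 1) * ((u - ω) * (u - ω ^ 2)) := by grind
  rw [← sub_eq_zero, this]
  simp [sub_eq_zero]

lemma inv_add_inv_add_inv_eq_zero {a b c : K} (ha : a ≠ 0) (hb : b ≠ 0) (hc : c ≠ 0)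
    (h : a * b + a * c + b * c = 0) : a⁻¹ + b⁻¹ + c⁻¹ = 0 := by
  field_simp
  linear_combination h

lemma add_inv_eq_add_inv_iff {u v : K} (hu : u ≠ 0) (hv : v ≠ 0) :
    1 + v + v⁻¹ = 1 + u + u⁻¹ ↔ v = u ∨ v = u⁻¹ := by
  constructor
  · intro h
    have : (v - u) * (v - u⁻¹) = 0 := by
      field_simp at h ⊢
      grind
    simpa [sub_eq_zero] using this
  · rintro (rfl | rfl)
    · rfl
    · rw [inv_inv]; ring

lemma sum_inv_ne_zero_of_ne_zero [CharP K 2] {x y z : K} (hx : x ≠ 0) (hy : y ≠ 0) (hz : z ≠ 0)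
    (hw : x + y + z ≠ 0) (hxy : x ≠ y) (hxz : x ≠ z) (hyz : y ≠ z) :
    x⁻¹ + y⁻¹ + z⁻¹ + (x + y + z)⁻¹ ≠ 0 := by
  intro h
  have h2 : (2 : K) = 0 := CharTwo.two_eq_zero
  have key : (x + y) * ((x + z) * (y + z)) = 0 := by
    field_simp at h
    linear_combination h - x * y * z * h2
  simp only [mul_eq_zero, CharTwo.add_eq_zero] at key
  tauto

variable [DecidableEq K]

lemma exists_eq_of_mem_VF [CharP K 2] {G : K → K} {S : Finset K} (hS : S ∈ VF G) {a : K}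
    (ha : a ∈ S) : ∃ y z : K, a ≠ y ∧ a ≠ z ∧ y ≠ z ∧
      G a + G y + G z + G (a + y + z) = 0 ∧ S = {a, y, z, a + y + z} := by
  obtain ⟨x, y, z, hxy, hxz, hyz, h, rfl⟩ := hS
  simp only [mem_insert, mem_singleton] at ha
  rcases ha with rfl | rfl | rfl | rfl
  · exact ⟨y, z, hxy, hxz, hyz, h, rfl⟩
  · refine ⟨x, z, hxy.symm, hyz, hxz, ?_, ?_⟩
    · rw [add_comm a x, ← h]; ring
    · ext t; simp only [mem_insert, mem_singleton, add_comm a x]; tauto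
  · refine ⟨x, y, hxz.symm, hyz.symm, hxy, ?_, ?_⟩
    · rw [show a + x + y = x + y + a by ring, ← h]; ring
    · ext t; simp only [mem_insert, mem_singleton, show a + x + y = x + y + a by ring]; tauto
  · have hz : x + y + z + x + y = z := by grind
    refine ⟨x, y, by grind, by grind, hxy, ?_, ?_⟩
    · rw [hz, ← h]; ring
    · ext t; simp only [mem_insert, mem_singleton, hz]; tauto

lemma image_mem_VF_of_involutive [CharP K 2] {G : K → K} (hG : Function.Involutive G)
    {S : Finset K} (hS : S ∈ VF G) : S.image G ∈ VF G := by
  obtain ⟨x, y, z, hxy, hxz, hyz, h, rfl⟩ := hS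
  have hw : G x + G y + G z = G (x + y + z) := by grind
  refine ⟨G x, G y, G z, hG.injective.ne hxy, hG.injective.ne hxz, hG.injective.ne hyz, ?_, ?_⟩
  · rw [hw, hG, hG, hG, hG]; grind
  · simp [image_insert, hw]

lemma Fmod_mul (α x : K) (hα : α ≠ 0) : Fmod α (α * x) = α⁻¹ * Fmod 1 x := by
  unfold Fmod
  by_cases hx : x = 0
  · simp [hx]
  · by_cases h1 : x = 1
    · simp [h1, hα]
    · simp [hx, h1, hα, mul_comm]

lemma VF_Fmod_eq_image (α : K) (hα : α ≠ 0) :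
    VF (Fmod α) = (fun S : Finset K => S.image (α * ·)) '' VF (Fmod 1) := by
  have hinj : Function.Injective (α * · : K → K) := mul_right_injective₀ hα
  ext S
  constructor
  · rintro ⟨x, y, z, hxy, hxz, hyz, h, rfl⟩
    obtain ⟨x, rfl⟩ : ∃ t, x = α * t := ⟨α⁻¹ * x, by field_simp⟩
    obtain ⟨y, rfl⟩ : ∃ t, y = α * t := ⟨α⁻¹ * y, by field_simp⟩
    obtain ⟨z, rfl⟩ : ∃ t, z = α * t := ⟨α⁻¹ * z, by field_simp⟩
    refine ⟨{x, y, z, x + y + z}, ⟨x, y, z, by grind, by grind, by grind, ?_, rfl⟩, ?_⟩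
    · simp only [← mul_add, Fmod_mul _ _ hα] at h
      simpa [hα] using h
    · simp [image_insert, mul_add]
  · rintro ⟨_, ⟨x, y, z, hxy, hxz, hyz, h, rfl⟩, rfl⟩
    refine ⟨α * x, α * y, α * z, hinj.ne hxy, hinj.ne hxz, hinj.ne hyz, ?_, ?_⟩
    · simp only [← mul_add, Fmod_mul _ _ hα, h, mul_zero]
    · simp [image_insert, mul_add]

lemma ncard_VF_Fmod (α : K) (hα : α ≠ 0) :
    (VF (Fmod α)).ncard = (VF (Fmod (1 : K))).ncard := by
  rw [VF_Fmod_eq_image α hα]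
  exact Set.ncard_image_of_injective _ (image_injective (mul_right_injective₀ hα))

lemma Fmod_one_involutive : Function.Involutive (Fmod (1 : K)) := by
  intro x
  unfold Fmod
  by_cases hx : x = 0
  · simp [hx]
  · by_cases h1 : x = 1
    · simp [h1]
    · simp [hx, h1]

/-- The `u`-th member of the family of vanishing flats of `Fmod 1` containing `1` but not `0`. -/
def oneFlat (ω u : K) : Finset K :=
  {1, 1 + u + u⁻¹, 1 + ω * u + (ω * u)⁻¹, 1 + ω ^ 2 * u + (ω ^ 2 * u)⁻¹}

/-- The `u`-th member of the family of vanishing flats of the inverse function. -/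
def zeroFlat (ω u : K) : Finset K := {0, u, ω * u, ω ^ 2 * u}

lemma zeroFlat_mem_VF [CharP K 2] {ω u : K} (hω : ω ^ 2 + ω + 1 = 0) (hu : u ≠ 0) :
    zeroFlat ω u ∈ VF (fun x : K => x⁻¹) := by
  obtain ⟨h1, h3⟩ := cubeRoot_inv hω
  have h4 : ω ≠ 0 := by rintro rfl; simp at hω
  have h5 : ω ≠ 1 := by grind
  have h6 : 0 + u + ω * u = ω ^ 2 * u := by grind
  refine ⟨0, u, ω * u, hu.symm, by simp [hu, h4], by grind, ?_, ?_⟩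
  · simp only [h6, mul_inv, h1, h3]; grind
  · rw [h6]; rfl

lemma exists_zeroFlat_eq [CharP K 2] {ω : K} (hω : ω ^ 2 + ω + 1 = 0) {S : Finset K}
    (hS : S ∈ VF (fun x : K => x⁻¹)) : ∃ u ≠ 0, zeroFlat ω u = S := by
  have h0 : 0 ∈ S := by
    obtain ⟨x, y, z, hxy, hxz, hyz, h, rfl⟩ := hS
    by_contra hn
    simp only [mem_insert, mem_singleton, not_or] at hn
    exact sum_inv_ne_zero_of_ne_zero (Ne.symm hn.1) (Ne.symm hn.2.1) (Ne.symm hn.2.2.1)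
      (Ne.symm hn.2.2.2) hxy hxz hyz h
  obtain ⟨y, z, hy, hz, hyz, h, rfl⟩ := exists_eq_of_mem_VF hS h0
  refine ⟨y, hy.symm, ?_⟩
  have hw : y + z ≠ 0 := by rwa [Ne, CharTwo.add_eq_zero]
  have hq : (z - ω * y) * (z - ω ^ 2 * y) = 0 := by
    have : y ^ 2 + y * z + z ^ 2 = 0 := by
      simp only [zero_add, inv_zero] at h
      have := hy.symm
      have := hz.symm
      field_simp at h
      grind
    grind
  unfold zeroFlat
  rcases mul_eq_zero.1 hq with h' | h'
  · have : 0 + y + z = ω ^ 2 * y := by grind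
    rw [this, sub_eq_zero.1 h']
  · have : 0 + y + z = ω * y := by grind
    rw [this, sub_eq_zero.1 h']
    congr 2
    exact pair_comm _ _

lemma zeroFlat_eq_iff {ω u v : K} (hω : ω ^ 2 + ω + 1 = 0) (hu : u ≠ 0) (hv : v ≠ 0) :
    zeroFlat ω v = zeroFlat ω u ↔ v ∈ ({u, ω * u, ω ^ 2 * u} : Finset K) := by
  have h3 : ω ^ 3 = 1 := by linear_combination (ω - 1) * hω
  constructor
  · intro h
    have : v ∈ zeroFlat ω u := h ▸ by simp [zeroFlat]
    simpa [zeroFlat, hv] using this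
  · intro h
    simp only [mem_insert, mem_singleton] at h
    have e1 : ω ^ 2 * (ω * u) = u := by grind
    have e2 : ω * (ω ^ 2 * u) = u := by grind
    have e3 : ω ^ 2 * (ω ^ 2 * u) = ω * u := by grind
    have e4 : ω * (ω * u) = ω ^ 2 * u := by grind
    rcases h with rfl | rfl | rfl
    · rfl
    all_goals
      ext t; simp only [zeroFlat, mem_insert, mem_singleton, e1, e2, e3, e4]; tauto

lemma card_cubeRoot_coset [CharP K 2] {ω u : K} (hω : ω ^ 2 + ω + 1 = 0) (hu : u ≠ 0) :
    ({u, ω * u, ω ^ 2 * u} : Finset K).card = 3 := by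
  have h0 : ω ≠ 0 := by rintro rfl; simp at hω
  have h1 : ω ≠ 1 := by grind
  have h2 : ω ^ 2 ≠ 1 := by grind
  have h3 : ω ^ 2 ≠ ω := by grind
  rw [card_eq_three]
  exact ⟨_, _, _, by grind, by grind, by grind, rfl⟩

lemma oneFlat_mem_VF [CharP K 2] {ω u : K} (hω : ω ^ 2 + ω + 1 = 0) (hu : u ≠ 0)
    (hu3 : u ^ 3 ≠ 1) :
    oneFlat ω u ∈ VF (Fmod (1 : K)) ∧ 1 ∈ oneFlat ω u ∧ 0 ∉ oneFlat ω u := by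
  obtain ⟨h1, h3⟩ := cubeRoot_inv hω
  have hv : u * u⁻¹ = 1 := mul_inv_cancel₀ hu
  rw [Ne, pow_three_eq_one_iff hω] at hu3
  push Not at hu3
  obtain ⟨ha, hb, hc⟩ := hu3
  unfold oneFlat
  simp only [mul_inv, h1, h3]
  generalize u⁻¹ = v at *
  have hprod : (1 + u + v) * (1 + ω * u + ω ^ 2 * v) + (1 + u + v) * (1 + ω ^ 2 * u + ω * v)
      + (1 + ω * u + ω ^ 2 * v) * (1 + ω ^ 2 * u + ω * v) = 0 := by
    clear hu ha hb hc h1 h3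
    grind
  have a1 : 1 + u + v ≠ 1 := by
    intro h
    have : (u - 1) ^ 2 = 0 := by grind
    grind
  have b1 : 1 + ω * u + ω ^ 2 * v ≠ 1 := by
    intro h
    have : (u - ω ^ 2) ^ 2 = 0 := by grind
    grind
  have c1 : 1 + ω ^ 2 * u + ω * v ≠ 1 := by
    intro h
    have : (u - ω) ^ 2 = 0 := by grind
    grind
  have a0 : 1 + u + v ≠ 0 := by
    intro h
    have : (u - ω) * (u - ω ^ 2) = 0 := by grind
    grind
  have b0 : 1 + ω * u + ω ^ 2 * v ≠ 0 := by
    intro h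
    have : (u - 1) * (u - ω) = 0 := by grind
    grind
  have c0 : 1 + ω ^ 2 * u + ω * v ≠ 0 := by
    intro h
    have : (u - 1) * (u - ω ^ 2) = 0 := by grind
    grind
  have hsum : 1 + (1 + u + v) + (1 + ω * u + ω ^ 2 * v) = 1 + ω ^ 2 * u + ω * v := by grind
  refine ⟨⟨1, 1 + u + v, 1 + ω * u + ω ^ 2 * v, a1.symm, b1.symm, by grind, ?_, ?_⟩, by simp, ?_⟩
  · rw [hsum]
    simp only [Fmod, a1, b1, c1, a0, b0, c0, one_ne_zero, if_true, if_false, zero_add]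
    exact inv_add_inv_add_inv_eq_zero a0 b0 c0 hprod
  · rw [hsum]
  · simp only [mem_insert, mem_singleton, not_or]
    exact ⟨zero_ne_one, a0.symm, b0.symm, c0.symm⟩

lemma exists_oneFlat_eq [CharP K 2] {ω : K} (hω : ω ^ 2 + ω + 1 = 0) {S : Finset K}
    (hS : S ∈ VF (Fmod (1 : K))) (h1 : 1 ∈ S) (h0 : 0 ∉ S) :
    ∃ u, (u ≠ 0 ∧ u ^ 3 ≠ 1) ∧ oneFlat ω u = S := by
  obtain ⟨hi1, hi2⟩ := cubeRoot_inv hω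
  obtain ⟨y, z, hy, hz, hyz, h, rfl⟩ := exists_eq_of_mem_VF hS h1
  simp only [mem_insert, mem_singleton, not_or] at h0
  obtain ⟨-, y0, z0, w0⟩ := h0
  have y0' := Ne.symm y0
  have z0' := Ne.symm z0
  have w0' := Ne.symm w0
  have w1 : 1 + y + z ≠ 1 := by grind
  simp only [Fmod, one_ne_zero, if_true, if_false, hy.symm, hz.symm, y0', z0', w0', w1,
    zero_add] at h
  have hq : y ^ 2 + z ^ 2 + y * z + y + z = 0 := by
    field_simp at h
    grind
  have huv : (1 + y + ω * (1 + z)) * (1 + y + ω ^ 2 * (1 + z)) = 1 := by grind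
  have hinv := inv_eq_of_mul_eq_one_right huv
  refine ⟨1 + y + ω * (1 + z), ⟨left_ne_zero_of_mul_eq_one huv, ?_⟩, ?_⟩
  · rw [Ne, pow_three_eq_one_iff hω]
    rintro (h' | h' | h') <;> grind
  · unfold oneFlat
    simp only [mul_inv, hinv, hi1, hi2]
    have e1 : 1 + (1 + y + ω * (1 + z)) + (1 + y + ω ^ 2 * (1 + z)) = z := by grind
    have e2 : 1 + ω * (1 + y + ω * (1 + z)) + ω ^ 2 * (1 + y + ω ^ 2 * (1 + z)) = 1 + y + z := by
      clear * - hω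
      grind
    have e3 : 1 + ω ^ 2 * (1 + y + ω * (1 + z)) + ω * (1 + y + ω ^ 2 * (1 + z)) = y := by
      clear * - hω
      grind
    rw [e1, e2, e3]
    ext t
    simp only [mem_insert, mem_singleton]
    tauto

lemma oneFlat_eq_iff [CharP K 2] {ω u v : K} (hω : ω ^ 2 + ω + 1 = 0) (hu : u ≠ 0) (hv : v ≠ 0)
    (hv3 : v ^ 3 ≠ 1) : oneFlat ω v = oneFlat ω u ↔
      v ∈ ({u, ω * u, ω ^ 2 * u} ∪ {u⁻¹, ω * u⁻¹, ω ^ 2 * u⁻¹} : Finset K) := by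
  obtain ⟨h1, h2⟩ := cubeRoot_inv hω
  have h3 : ω ^ 3 = 1 := by linear_combination (ω - 1) * hω
  have h0 : ω ≠ 0 := by rintro rfl; simp at hω
  constructor
  · intro h
    have hmem : 1 + v + v⁻¹ ∈ oneFlat ω u := h ▸ by simp [oneFlat]
    have hne : 1 + v + v⁻¹ ≠ 1 := by
      intro h'
      have : (v - 1) ^ 2 = 0 := by field_simp at h'; grind
      grind
    simp only [oneFlat, mem_insert, mem_singleton, hne, false_or,
      add_inv_eq_add_inv_iff hu hv, add_inv_eq_add_inv_iff (mul_ne_zero h0 hu) hv,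
      add_inv_eq_add_inv_iff (mul_ne_zero (pow_ne_zero 2 h0) hu) hv] at hmem
    simp only [mul_inv, h1, h2] at hmem
    simp only [mem_union, mem_insert, mem_singleton]
    tauto
  · intro h
    have key : ∀ t : K, oneFlat ω (ω * t) = oneFlat ω t := by
      intro t
      have e1 : ω * (ω * t) = ω ^ 2 * t := by ring
      have e2 : ω ^ 2 * (ω * t) = t := by grind
      ext s
      simp only [oneFlat, e1, e2, mem_insert, mem_singleton]
      tauto
    have key2 : ∀ t : K, oneFlat ω (ω ^ 2 * t) = oneFlat ω t := by
      intro t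
      rw [show ω ^ 2 * t = ω * (ω * t) by ring, key, key]
    have key3 : ∀ t : K, oneFlat ω t⁻¹ = oneFlat ω t := by
      intro t
      ext s
      simp only [oneFlat, mul_inv, inv_inv, h1, h2, mem_insert, mem_singleton, add_right_comm _ t⁻¹,
        add_right_comm _ (_ * t⁻¹)]
      tauto
    simp only [mem_union, mem_insert, mem_singleton] at h
    rcases h with (rfl | rfl | rfl) | rfl | rfl | rfl <;> simp only [key, key2, key3]

lemma card_cubeRoot_coset_union_inv [CharP K 2] {ω u : K} (hω : ω ^ 2 + ω + 1 = 0) (hu : u ≠ 0)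
    (hu3 : u ^ 3 ≠ 1) :
    ({u, ω * u, ω ^ 2 * u} ∪ {u⁻¹, ω * u⁻¹, ω ^ 2 * u⁻¹} : Finset K).card = 6 := by
  have h3 : ω ^ 3 = 1 := by linear_combination (ω - 1) * hω
  rw [card_union_of_disjoint, card_cubeRoot_coset hω hu, card_cubeRoot_coset hω (inv_ne_zero hu)]
  rw [disjoint_left]
  intro t ht ht'
  simp only [mem_insert, mem_singleton] at ht ht'
  have e1 : t ^ 3 = u ^ 3 := by rcases ht with rfl | rfl | rfl <;> grind
  have e2 : t ^ 3 = (u ^ 3)⁻¹ := by rcases ht' with rfl | rfl | rfl <;> grind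
  rw [e1] at e2
  apply hu3
  have : (u ^ 3 - 1) ^ 2 = 0 := by
    have : u ^ 3 * u ^ 3 = 1 := by
      nth_rewrite 2 [e2]; exact mul_inv_cancel₀ (pow_ne_zero 3 hu)
    grind
  grind

lemma mem_VF_Fmod_one_and_zero_mem_one_mem_iff [CharP K 2] {ω : K} (hω : ω ^ 2 + ω + 1 = 0)
    (S : Finset K) : (S ∈ VF (Fmod (1 : K)) ∧ 0 ∈ S ∧ 1 ∈ S) ↔ S = zeroFlat ω 1 := by
  obtain ⟨h1, h2⟩ := cubeRoot_inv hω
  have h0 : ω ≠ 0 := by rintro rfl; simp at hω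
  have hn1 : ω ≠ 1 := by grind
  have h20 : ω ^ 2 ≠ 0 := pow_ne_zero 2 h0
  have h21 : ω ^ 2 ≠ 1 := by grind
  constructor
  · rintro ⟨hS, h_zero, ho⟩
    obtain ⟨y, z, hy, hz, hyz, h, rfl⟩ := exists_eq_of_mem_VF hS h_zero
    have hS' : (({0, y, z, 0 + y + z} : Finset K)) ∈ VF (fun x : K => x⁻¹) := by
      refine ⟨0, y, z, hy, hz, hyz, ?_, rfl⟩
      simp only [mem_insert, mem_singleton, one_ne_zero, false_or] at ho
      simp only [Fmod, zero_add] at h ho ⊢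
      have hw : y + z ≠ 0 := by rwa [Ne, CharTwo.add_eq_zero]
      rcases ho with rfl | rfl | ho
      · have : 1 + z ≠ 1 := by simpa using hz.symm
        simp_all [Ne.symm]
      · have : y + 1 ≠ 1 := by simpa using hy.symm
        simp_all [Ne.symm]
        linear_combination h
      · have : y ≠ 1 := by grind
        have : z ≠ 1 := by grind
        simp only [← ho] at h ⊢
        simp_all only [hy.symm, hz.symm, if_true, if_false, inv_zero]
        grind
    obtain ⟨u, hu, hu'⟩ := exists_zeroFlat_eq hω hS'
    rw [← hu'] at ho ⊢
    rw [eq_comm, zeroFlat_eq_iff hω hu one_ne_zero]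
    simpa [zeroFlat] using ho
  · rintro rfl
    refine ⟨⟨0, 1, ω, zero_ne_one, h0.symm, hn1.symm, ?_, ?_⟩, by simp [zeroFlat], by
      simp [zeroFlat]⟩
    · rw [show 0 + 1 + ω = ω ^ 2 by grind]
      simp only [Fmod, h0, hn1, h20, h21, one_ne_zero, if_true, if_false, inv_one, h1, h2]
      grind
    · rw [show 0 + 1 + ω = ω ^ 2 by grind]
      simp [zeroFlat]

lemma zero_mem_or_one_mem_of_mem_VF_Fmod_one [CharP K 2] {S : Finset K}
    (hS : S ∈ VF (Fmod (1 : K))) : 0 ∈ S ∨ 1 ∈ S := by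
  by_contra! hn
  obtain ⟨x, y, z, hxy, hxz, hyz, h, rfl⟩ := hS
  simp only [mem_insert, mem_singleton, not_or] at hn
  obtain ⟨⟨a0, b0, c0, d0⟩, a1, b1, c1, d1⟩ := hn
  simp only [Fmod, Ne.symm a0, Ne.symm b0, Ne.symm c0, Ne.symm d0, Ne.symm a1, Ne.symm b1,
    Ne.symm c1, Ne.symm d1, if_false] at h
  exact sum_inv_ne_zero_of_ne_zero (Ne.symm a0) (Ne.symm b0) (Ne.symm c0) (Ne.symm d0)
    hxy hxz hyz h

lemma mem_image_Fmod_one (S : Finset K) : (0 ∈ S.image (Fmod (1 : K)) ↔ 1 ∈ S) ∧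
    (1 ∈ S.image (Fmod (1 : K)) ↔ 0 ∈ S) := by
  have h0 : Fmod (1 : K) 1 = 0 := by simp [Fmod]
  have h1 : Fmod (1 : K) 0 = 1 := by simp [Fmod]
  constructor
  · nth_rewrite 1 [← h0]
    exact Fmod_one_involutive.injective.mem_finset_image
  · nth_rewrite 2 [← h1]
    exact Fmod_one_involutive.injective.mem_finset_image

end GeneralFlats

section Counting

lemma card_eq_mul_card_of_fiber {α β : Type*} [DecidableEq α] [DecidableEq β] {s : Finset α}
    {t : Finset β} (f : α → β) (k : ℕ) (hf : ∀ a ∈ s, f a ∈ t) (hsurj : ∀ b ∈ t, ∃ a ∈ s, f a = b)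
    (hfib : ∀ a ∈ s, (s.filter fun a' => f a' = f a).card = k) : s.card = k * t.card := by
  rw [card_eq_sum_card_fiberwise (f := f) (t := t) hf, sum_const_nat (m := k), mul_comm]
  intro b hb
  obtain ⟨a, ha, rfl⟩ := hsurj b hb
  exact hfib a ha

lemma exists_primitive_cubeRoot [CharP F 2] (n : ℕ) (heven : Even n)
    (hcard : Fintype.card F = 2 ^ n) : ∃ ω : F, ω ^ 2 + ω + 1 = 0 := by
  have hdvd : 3 ∣ Fintype.card Fˣ := by
    rw [Fintype.card_units, hcard]
    obtain ⟨k, rfl⟩ := heven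
    rw [← two_mul, pow_mul]
    simpa using Nat.sub_dvd_pow_sub_pow 4 1 k
  have : Fact (Nat.Prime 3) := ⟨Nat.prime_three⟩
  obtain ⟨g, hg⟩ := exists_prime_orderOf_dvd_card 3 hdvd
  refine ⟨g, ?_⟩
  have h3 : (g : F) ^ 3 = 1 := by
    rw [← Units.val_pow_eq_pow_val, ← hg, pow_orderOf_eq_one, Units.val_one]
  have h1 : (g : F) ≠ 1 := by
    intro h
    rw [Units.val_eq_one.1 h, orderOf_one] at hg
    omega
  have : ((g : F) - 1) * ((g : F) ^ 2 + g + 1) = 0 := by linear_combination h3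
  exact (mul_eq_zero.1 this).resolve_left (sub_ne_zero.2 h1)

lemma three_mul_ncard_VF_inv [CharP F 2] {ω : F} (hω : ω ^ 2 + ω + 1 = 0) :
    3 * (VF (fun x : F => x⁻¹)).ncard = Fintype.card F - 1 := by
  classical
  rw [Set.ncard_eq_toFinset_card', ← card_univ, ← card_erase_of_mem (mem_univ (0 : F))]
  symm
  apply card_eq_mul_card_of_fiber (zeroFlat ω)
  · intro u hu
    simpa using zeroFlat_mem_VF hω (ne_of_mem_erase hu)
  · intro S hS
    obtain ⟨u, hu, h⟩ := exists_zeroFlat_eq hω (Set.mem_toFinset.1 hS)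
    exact ⟨u, by simpa using hu, h⟩
  · intro u hu
    have hu := ne_of_mem_erase hu
    have h0 : ω ≠ 0 := by rintro rfl; simp at hω
    rw [← card_cubeRoot_coset hω hu]
    congr 1
    ext v
    by_cases hv : v = 0
    · simp [hv, hu.symm, hu, h0]
    · simp only [mem_filter, mem_erase, mem_univ, zeroFlat_eq_iff hω hu hv, and_true, ne_eq, hv,
        not_false_eq_true, true_and]

lemma card_filter_ne_zero_and_pow_three_ne_one [CharP F 2] {ω : F} (hω : ω ^ 2 + ω + 1 = 0) :
    (univ.filter fun u : F => u ≠ 0 ∧ u ^ 3 ≠ 1).card + 4 = Fintype.card F := by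
  have h0 : ω ≠ 0 := by rintro rfl; simp at hω
  have h : (univ.filter fun u : F => ¬(u ≠ 0 ∧ u ^ 3 ≠ 1)) = insert 0 {1, ω * 1, ω ^ 2 * 1} := by
    ext u
    simp only [mem_filter, mem_univ, true_and, not_and_or, not_not, pow_three_eq_one_iff hω,
      mem_insert, mem_singleton, mul_one, ne_eq]
  have hc : (univ.filter fun u : F => ¬(u ≠ 0 ∧ u ^ 3 ≠ 1)).card = 4 := by
    rw [h, card_insert_of_notMem (by simp [h0.symm, (pow_ne_zero 2 h0).symm]),
      card_cubeRoot_coset hω one_ne_zero]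
  rw [← card_univ, ← card_filter_add_card_filter_not (s := univ)
    (fun u : F => u ≠ 0 ∧ u ^ 3 ≠ 1), hc]

lemma three_mul_ncard_VF_Fmod_one [CharP F 2] {ω : F} (hω : ω ^ 2 + ω + 1 = 0) :
    3 * (VF (Fmod (1 : F))).ncard = Fintype.card F - 1 := by
  classical
  rw [Set.ncard_eq_toFinset_card']
  set V := (VF (Fmod (1 : F))).toFinset with hV
  have hmem : ∀ S, S ∈ V ↔ S ∈ VF (Fmod (1 : F)) := fun S => Set.mem_toFinset
  have hboth : (V.filter fun S => 0 ∈ S ∧ 1 ∈ S).card = 1 := by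
    rw [card_eq_one]
    refine ⟨zeroFlat ω 1, ?_⟩
    ext S
    rw [mem_filter, hmem, mem_VF_Fmod_one_and_zero_mem_one_mem_iff hω, mem_singleton]
  have hone : (univ.filter fun u : F => u ≠ 0 ∧ u ^ 3 ≠ 1).card =
      6 * (V.filter fun S => 1 ∈ S ∧ 0 ∉ S).card := by
    apply card_eq_mul_card_of_fiber (oneFlat ω)
    · intro u hu
      obtain ⟨hu, hu3⟩ := (mem_filter.1 hu).2
      simpa [hmem] using oneFlat_mem_VF hω hu hu3
    · intro S hS
      rw [mem_filter, hmem] at hS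
      obtain ⟨u, hu, h⟩ := exists_oneFlat_eq hω hS.1 hS.2.1 hS.2.2
      exact ⟨u, by simpa using hu, h⟩
    · intro u hu
      obtain ⟨hu, hu3⟩ := (mem_filter.1 hu).2
      rw [← card_cubeRoot_coset_union_inv hω hu hu3]
      congr 1
      ext v
      have h3 : ω ^ 3 = 1 := by linear_combination (ω - 1) * hω
      have h0 : ω ≠ 0 := by rintro rfl; simp at hω
      constructor
      · intro hv
        simp only [mem_filter, mem_univ, true_and] at hv
        exact (oneFlat_eq_iff hω hu hv.1.1 hv.1.2).1 hv.2
      · intro hv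
        have hv' : v ≠ 0 ∧ v ^ 3 ≠ 1 := by
          simp only [mem_union, mem_insert, mem_singleton] at hv
          rcases hv with (rfl | rfl | rfl) | rfl | rfl | rfl <;>
            simp [mul_pow, h3, hu, h0, hu3, ← pow_mul, pow_mul' ω 2 3]
        simp only [mem_filter, mem_univ, true_and]
        exact ⟨hv', (oneFlat_eq_iff hω hu hv'.1 hv'.2).2 hv⟩
  have hswap : (V.filter fun S => 0 ∈ S ∧ 1 ∉ S).card =
      (V.filter fun S => 1 ∈ S ∧ 0 ∉ S).card := by
    have hinv : ∀ S : Finset F, (S.image (Fmod 1)).image (Fmod 1) = S := by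
      intro S
      rw [image_image, Fmod_one_involutive.comp_self, image_id]
    refine card_nbij' (fun S => S.image (Fmod 1)) (fun S => S.image (Fmod 1)) ?_ ?_
      (fun S _ => hinv S) (fun S _ => hinv S)
    all_goals
      intro S hS
      simp only [coe_filter, Set.mem_ofPred_eq, hmem, mem_image_Fmod_one] at hS ⊢
      exact ⟨image_mem_VF_of_involutive Fmod_one_involutive hS.1, hS.2⟩
  have hsplit : V.card = (V.filter fun S => 0 ∈ S ∧ 1 ∈ S).card +
      ((V.filter fun S => 0 ∈ S ∧ 1 ∉ S).card + (V.filter fun S => 1 ∈ S ∧ 0 ∉ S).card) := by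
    rw [← card_union_of_disjoint, ← card_union_of_disjoint]
    · congr 1
      ext S
      simp only [mem_union, mem_filter]
      have := fun h => zero_mem_or_one_mem_of_mem_VF_Fmod_one ((hmem S).1 h)
      tauto
    · rw [disjoint_left]
      intro S
      simp only [mem_union, mem_filter]
      tauto
    · rw [disjoint_left]
      intro S
      simp only [mem_filter]
      tauto
  have := card_filter_ne_zero_and_pow_three_ne_one hω
  omega

end Counting

/-- for even `n ≥ 4`, `F_{0,α}` and the inverse function have the
same number `(q−1)/3` of vanishing flats. -/
theorem stmt_16 (n : ℕ) (hn : 4 ≤ n) (heven : Even n)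
    [CharP F 2] (hcard : Fintype.card F = 2 ^ n)
    (α : F) (hα : α ≠ 0) :
    (VF (Fmod α)).ncard = (VF (fun x : F => x ^ (2 ^ n - 2))).ncard ∧
    3 * (VF (fun x : F => x ^ (2 ^ n - 2))).ncard = 2 ^ n - 1 ∧
    3 * (VF (Fmod α)).ncard = 2 ^ n - 1 := by
  obtain ⟨ω, hω⟩ := exists_primitive_cubeRoot n heven hcard
  have hpow : (fun x : F => x ^ (2 ^ n - 2)) = fun x => x⁻¹ := by
    have h4 : 2 ^ 4 ≤ 2 ^ n := Nat.pow_le_pow_right two_pos hn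
    funext x
    by_cases hx : x = 0
    · rw [hx, inv_zero, zero_pow (by omega)]
    · apply eq_inv_of_mul_eq_one_left
      rw [← pow_succ, show 2 ^ n - 2 + 1 = Fintype.card F - 1 by omega]
      exact FiniteField.pow_card_sub_one_eq_one x hx
  have h1 := three_mul_ncard_VF_inv hω
  have h2 := three_mul_ncard_VF_Fmod_one hω
  rw [hpow, ncard_VF_Fmod α hα]
  omega

end APNPaper
end
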